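/- For ν ∈ ℤ and ζ ∈ ℂ define f_ν(ζ) := (1/(2πi)) ∮_{|s|=1} e^{−ζ s + 1/s} s^{ν−1} ds, the contour integral over the positively oriented unit circle. Then for every S ≥ 1 and all complex numbers y_1,…,y_{2S}: det[ f_{ν−ℓ+1}(y_j) ]_{ℓ,j=1}^{2S} = (1/(2S)!) · (2πi)^{−2S} · ∮_{|t_1|=1} ⋯ ∮_{|t_{2S}|=1} ( ∏_{1≤j<k≤2S}(t_j − t_k) ) · det[ e^{−y_j t_k} ]_{j,k=1}^{2S} · ∏_{k=1}^{2S} e^{1/t_k} t_k^{ν−2S} dt_1 ⋯ dt_{2S}. -/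

import Mathlib

open Finset

/-- The Bessel-type contour integral
`f_ν(ζ) = (1/(2πi)) ∮_{|s|=1} e^{-ζ s + 1/s} s^{ν-1} ds`. -/
noncomputable def besselF (ν : ℤ) (ζ : ℂ) : ℂ :=
  (2 * (Real.pi : ℂ) * Complex.I)⁻¹ *
    circleIntegral (fun s : ℂ => Complex.exp (-ζ * s + 1 / s) * s ^ (ν - 1)) 0 1

/-- The `n`-fold iterated contour integral over the positively oriented unit circle:
`∮_{|t_1|=1} ⋯ ∮_{|t_n|=1} F(t_1,…,t_n) dt_n ⋯ dt_1`. -/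
noncomputable def multiCircle : (n : ℕ) → ((Fin n → ℂ) → ℂ) → ℂ
  | 0, F => F (fun i => i.elim0)
  | n + 1, F => circleIntegral (fun t : ℂ => multiCircle n (fun v => F (Fin.cons t v))) 0 1
/-- An iterated circle integral of a linear combination of products of one-variable functions is
the same linear combination of products of circle integrals. -/
lemma multiCircle_sum_mul_prod {ι : Type*} (s : Finset ι) (n : ℕ) (c : ι → ℂ)
    (g : ι → Fin n → ℂ → ℂ) (hg : ∀ i k, CircleIntegrable (g i k) 0 1) :
    multiCircle n (fun t => ∑ i ∈ s, c i * ∏ k, g i k (t k)) =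
      ∑ i ∈ s, c i * ∏ k, circleIntegral (g i k) 0 1 := by
  induction n generalizing c with
  | zero => simp [multiCircle]
  | succ n ih =>
    simp only [multiCircle, Fin.prod_univ_succ, Fin.cons_zero, Fin.cons_succ, ← mul_assoc]
    simp only [fun t => ih (fun i => c i * g i 0 t) (fun i k => g i k.succ) fun i k => hg i k.succ]
    have h (i : ι) (t : ℂ) : c i * g i 0 t * ∏ k : Fin n, circleIntegral (g i k.succ) 0 1 =
        (c i * ∏ k : Fin n, circleIntegral (g i k.succ) 0 1) • g i 0 t := by
      rw [smul_eq_mul]; ring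
    simp only [h]
    rw [circleIntegral.integral_fun_sum fun i _ => (hg i 0).const_fun_smul]
    refine Finset.sum_congr rfl fun i _ => ?_
    rw [circleIntegral.integral_smul, smul_eq_mul]
    ring

lemma prod_lt_sub_eq_sum_perm {R : Type*} [CommRing R] (n : ℕ) (t : Fin n → R) :
    ∏ p ∈ univ.filter (fun p : Fin n × Fin n => p.1 < p.2), (t p.1 - t p.2) =
      ∑ σ : Equiv.Perm (Fin n), (Equiv.Perm.sign σ : R) * ∏ k, t k ^ ((σ k).rev : ℕ) := by
  have h := Matrix.det_projVandermonde (fun _ : Fin n => (1 : R)) t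
  simp only [one_mul] at h
  rw [← Matrix.det_transpose, Matrix.det_apply'] at h
  simp only [Matrix.transpose_apply, Matrix.projVandermonde_apply, one_pow, one_mul] at h
  rw [h]
  exact Finset.prod_finset_product' (f := fun i j => t i - t j) _ univ (fun i => Ioi i)
    (by simp)

lemma sum_perm_sum_perm_prod {R : Type*} [CommRing R] {m : Type*} [Fintype m] [DecidableEq m]
    (M : Matrix m m R) :
    ∑ p : Equiv.Perm m × Equiv.Perm m, (Equiv.Perm.sign p.1 * Equiv.Perm.sign p.2 : R) *
      ∏ k, M (p.1 k) (p.2 k) = (Fintype.card m).factorial * M.det := by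
  have h (σ : Equiv.Perm m) : ∑ τ : Equiv.Perm m, (Equiv.Perm.sign σ * Equiv.Perm.sign τ : R) *
      ∏ k, M (σ k) (τ k) = M.det := by
    have h1 : (M.submatrix σ id).transpose.det = Equiv.Perm.sign σ * M.det := by
      rw [Matrix.det_transpose, Matrix.det_permute]
    rw [Matrix.det_apply'] at h1
    simp only [mul_assoc, ← Finset.mul_sum]
    simp only [Matrix.transpose_apply, Matrix.submatrix_apply, id] at h1
    rw [h1, ← mul_assoc, ← Int.cast_mul, ← Units.val_mul, Int.units_mul_self]
    simp
  rw [Fintype.sum_prod_type]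
  simp [h, Fintype.card_perm]

lemma circleIntegrable_weight_mul (ν : ℤ) (a : ℂ) (m : ℕ) :
    CircleIntegrable
      (fun s : ℂ => s ^ m * Complex.exp (-a * s) * (Complex.exp (1 / s) * s ^ ν)) 0 1 := by
  refine ContinuousOn.circleIntegrable zero_le_one fun s hs => ContinuousAt.continuousWithinAt ?_
  have hs0 : s ≠ 0 := ne_zero_of_mem_unit_sphere ⟨s, hs⟩
  have h1 : ContinuousAt (fun s : ℂ => s ^ ν) s := continuousAt_zpow₀ s ν (Or.inl hs0)
  fun_prop (disch := assumption)

lemma circleIntegral_weight_mul (ν : ℤ) (a : ℂ) (n : ℕ) (l : Fin n) :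
    circleIntegral (fun s : ℂ => s ^ (l.rev : ℕ) * Complex.exp (-a * s) *
      (Complex.exp (1 / s) * s ^ (ν - n))) 0 1 =
      2 * (Real.pi : ℂ) * Complex.I * besselF (ν - (l : ℕ)) a := by
  rw [besselF, mul_inv_cancel_left₀ Complex.two_pi_I_ne_zero]
  refine circleIntegral.integral_congr zero_le_one fun s hs => ?_
  have hs0 : s ≠ 0 := ne_zero_of_mem_unit_sphere ⟨s, hs⟩
  have he : ν - (l : ℕ) - 1 = ((l.rev : ℕ) : ℤ) + (ν - n) := by
    rw [Fin.val_rev]; omega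
  rw [he, zpow_add₀ hs0, zpow_natCast, Complex.exp_add]
  ring

/-- The Andréief identity for the weight `e^{1/t} t^{ν-n}` on the unit circle. -/
lemma multiCircle_prod_sub_mul_det (ν : ℤ) (n : ℕ) (y : Fin n → ℂ) :
    multiCircle n (fun t =>
      (∏ p ∈ univ.filter (fun p : Fin n × Fin n => p.1 < p.2), (t p.1 - t p.2)) *
        Matrix.det (Matrix.of fun j k : Fin n => Complex.exp (-(y j) * t k)) *
        ∏ k, Complex.exp (1 / t k) * t k ^ (ν - n)) =
      n.factorial * ((2 * (Real.pi : ℂ) * Complex.I) ^ n *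
        Matrix.det (Matrix.of fun l j : Fin n => besselF (ν - (l : ℕ)) (y j))) := by
  have h (t : Fin n → ℂ) :
      (∏ p ∈ univ.filter (fun p : Fin n × Fin n => p.1 < p.2), (t p.1 - t p.2)) *
        Matrix.det (Matrix.of fun j k : Fin n => Complex.exp (-(y j) * t k)) *
        ∏ k, Complex.exp (1 / t k) * t k ^ (ν - n) =
      ∑ p : Equiv.Perm (Fin n) × Equiv.Perm (Fin n),
        (Equiv.Perm.sign p.1 * Equiv.Perm.sign p.2 : ℂ) *
          ∏ k, (t k ^ ((p.1 k).rev : ℕ) * Complex.exp (-(y (p.2 k)) * t k) *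
            (Complex.exp (1 / t k) * t k ^ (ν - n))) := by
    rw [prod_lt_sub_eq_sum_perm, Matrix.det_apply', Finset.sum_mul_sum, ← Fintype.sum_prod_type',
      Finset.sum_mul]
    refine Finset.sum_congr rfl fun p _ => ?_
    simp only [Matrix.of_apply, Finset.prod_mul_distrib]
    ring
  simp only [h]
  rw [multiCircle_sum_mul_prod _ n _ (fun (p : Equiv.Perm (Fin n) × Equiv.Perm (Fin n)) k s =>
    s ^ ((p.1 k).rev : ℕ) * Complex.exp (-(y (p.2 k)) * s) *
      (Complex.exp (1 / s) * s ^ (ν - n))) fun p k => circleIntegrable_weight_mul _ _ _]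
  simp only [circleIntegral_weight_mul]
  have hM := sum_perm_sum_perm_prod ((2 * (Real.pi : ℂ) * Complex.I) •
    Matrix.of fun l j : Fin n => besselF (ν - (l : ℕ)) (y j))
  rw [Matrix.det_smul, Fintype.card_fin] at hM
  exact hM

/-- the Andreief-type multi-contour representation of
`det[f_{ν-ℓ+1}(y_j)]` (proof of Theorem 1.2 of the paper). -/
theorem stmt_17 (ν : ℤ) (S : ℕ) (hS : 1 ≤ S) (y : Fin (2 * S) → ℂ) :
    Matrix.det (Matrix.of fun ℓ j : Fin (2 * S) => besselF (ν - (ℓ : ℕ)) (y j))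
      = (((2 * S).factorial : ℂ))⁻¹ * (2 * (Real.pi : ℂ) * Complex.I) ^ (-(2 * (S : ℤ))) *
        multiCircle (2 * S) (fun t =>
          (∏ p ∈ Finset.univ.filter (fun p : Fin (2 * S) × Fin (2 * S) => p.1 < p.2),
            (t p.1 - t p.2)) *
          Matrix.det (Matrix.of fun j k : Fin (2 * S) => Complex.exp (-(y j) * t k)) *
          ∏ k, Complex.exp (1 / t k) * t k ^ (ν - 2 * (S : ℤ))) := by
  have h := multiCircle_prod_sub_mul_det ν (2 * S) y
  push_cast at h
  have hf : ((2 * S).factorial : ℂ) ≠ 0 := Nat.cast_ne_zero.mpr (Nat.factorial_ne_zero _)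
  have hp : (2 * (Real.pi : ℂ) * Complex.I) ^ (2 * S) ≠ 0 := pow_ne_zero _ Complex.two_pi_I_ne_zero
  have he : (2 * (Real.pi : ℂ) * Complex.I) ^ (-(2 * (S : ℤ))) =
      ((2 * (Real.pi : ℂ) * Complex.I) ^ (2 * S))⁻¹ := by
    rw [zpow_neg, ← zpow_natCast]; push_cast; rfl
  rw [h, he]
  field_simp
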